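/- In the partition algebra A_k(z) (k ≥ 2): for every i with 1 ≤ i ≤ k−1 one has p_{i+1/2} L_i p_{i+1/2} = p_{i+1/2}. -/

import Mathlib

open Polynomial

/-- Elements of an algebra over `R = ℤ[z]` (with `z = Polynomial.X`) satisfying the
defining relations of the partition algebra `A_k(z)` of Halverson–Ram.
Here `p i` stands for the generator `p_i` (for `1 ≤ i ≤ k`), `q i` stands for the
half-integer generator `p_{i+1/2}` (for `1 ≤ i ≤ k-1`), and `s i` stands for `s_i`
(for `1 ≤ i ≤ k-1`). -/
structure PartitionAlgebra (k : ℕ) (A : Type*) [Ring A] [Algebra (Polynomial ℤ) A] where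
  p : ℕ → A
  q : ℕ → A
  s : ℕ → A
  s_sq : ∀ i, 1 ≤ i → i ≤ k - 1 → s i * s i = 1
  s_comm : ∀ i j, 1 ≤ i → i ≤ k - 1 → 1 ≤ j → j ≤ k - 1 → j ≠ i + 1 → i ≠ j + 1 →
    s i * s j = s j * s i
  braid : ∀ i, 1 ≤ i → i + 1 ≤ k - 1 →
    s i * s (i + 1) * s i = s (i + 1) * s i * s (i + 1)
  p_sq : ∀ i, 1 ≤ i → i ≤ k → p i * p i = (X : Polynomial ℤ) • p i
  q_sq : ∀ i, 1 ≤ i → i ≤ k - 1 → q i * q i = q i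
  s_q : ∀ i, 1 ≤ i → i ≤ k - 1 → s i * q i = q i
  q_s : ∀ i, 1 ≤ i → i ≤ k - 1 → q i * s i = q i
  s_pp : ∀ i, 1 ≤ i → i ≤ k - 1 → s i * (p i * p (i + 1)) = p i * p (i + 1)
  pp_s : ∀ i, 1 ≤ i → i ≤ k - 1 → p i * p (i + 1) * s i = p i * p (i + 1)
  p_comm : ∀ i j, 1 ≤ i → i ≤ k → 1 ≤ j → j ≤ k → p i * p j = p j * p i
  q_comm : ∀ i j, 1 ≤ i → i ≤ k - 1 → 1 ≤ j → j ≤ k - 1 → q i * q j = q j * q i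
  q_p : ∀ i j, 1 ≤ i → i ≤ k - 1 → 1 ≤ j → j ≤ k → j ≠ i → j ≠ i + 1 →
    q i * p j = p j * q i
  s_p : ∀ i j, 1 ≤ i → i ≤ k - 1 → 1 ≤ j → j ≤ k → j ≠ i → j ≠ i + 1 →
    s i * p j = p j * s i
  s_q' : ∀ i j, 1 ≤ i → i ≤ k - 1 → 1 ≤ j → j ≤ k - 1 → j + 1 ≠ i → j ≠ i + 1 →
    s i * q j = q j * s i
  sps : ∀ i, 1 ≤ i → i ≤ k - 1 → s i * p i * s i = p (i + 1)
  sqs : ∀ i, 2 ≤ i → i ≤ k - 1 →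
    s i * q (i - 1) * s i = s (i - 1) * q i * s (i - 1)
  qpq₁ : ∀ i, 1 ≤ i → i ≤ k - 1 → q i * p i * q i = q i
  qpq₂ : ∀ i, 1 ≤ i → i ≤ k - 1 → q i * p (i + 1) * q i = q i
  pqp₁ : ∀ i, 2 ≤ i → i ≤ k → p i * q (i - 1) * p i = p i
  pqp₂ : ∀ i, 1 ≤ i → i ≤ k - 1 → p i * q i * p i = p i

namespace PartitionAlgebra

variable {k : ℕ} {A : Type*} [Ring A] [Algebra (Polynomial ℤ) A]

/-- `(P.LS i).1 = L_i` and `(P.LS i).2 = σ_i` (with the junk value `σ_0 := 1`). -/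
def LS (P : PartitionAlgebra k A) : ℕ → A × A
  | 0 => (0, 1)
  | 1 => (P.p 1, 1)
  | n + 2 =>
    let Lp := (P.LS (n + 1)).1
    let sp := (P.LS (n + 1)).2
    let Lpp := (P.LS n).1
    let snew : A :=
      if n = 0 then P.s 1
      else
        P.s n * P.s (n + 1) * sp * P.s (n + 1) * P.s n
          + P.s (n + 1) * P.q n * Lpp * P.s (n + 1) * P.q n * P.s (n + 1)
          + P.q n * Lpp * P.s (n + 1) * P.q n
          - P.s (n + 1) * P.q n * Lpp * P.s n * P.q (n + 1) * P.p (n + 1) * P.q n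
          - P.q n * P.p (n + 1) * P.q (n + 1) * P.s n * Lpp * P.q n * P.s (n + 1)
    (-(P.s (n + 1) * Lp * P.q (n + 1)) - P.q (n + 1) * Lp * P.s (n + 1)
        + P.q (n + 1) * Lp * P.p (n + 2) * P.q (n + 1)
        + P.s (n + 1) * Lp * P.s (n + 1) + snew,
      snew)

/-- The Jucys–Murphy element `L_i` of the partition algebra. -/
def L (P : PartitionAlgebra k A) (i : ℕ) : A := (P.LS i).1

/-- The element `σ_i` of the partition algebra. -/
def sig (P : PartitionAlgebra k A) (i : ℕ) : A := (P.LS i).2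

/-- `(P.LSh i).1 = L_{i+1/2}` and `(P.LSh i).2 = σ_{i+1/2}`. -/
def LSh (P : PartitionAlgebra k A) : ℕ → A × A
  | 0 => (0, 1)
  | 1 =>
    (-(P.L 1 * P.q 1) - P.q 1 * P.L 1 + P.q 1 * P.L 1 * P.p 1 * P.q 1
        + P.s 1 * (0 : A) * P.s 1 + 1, 1)
  | n + 2 =>
    let Lhp := (P.LSh (n + 1)).1
    let shp := (P.LSh (n + 1)).2
    let snew : A :=
      P.s (n + 1) * P.s (n + 2) * shp * P.s (n + 2) * P.s (n + 1)
        + P.q (n + 1) * P.L (n + 1) * P.s (n + 2) * P.q (n + 1) * P.s (n + 2)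
        + P.s (n + 2) * P.q (n + 1) * P.L (n + 1) * P.s (n + 2) * P.q (n + 1)
        - P.q (n + 1) * P.L (n + 1) * P.s (n + 1) * P.q (n + 2) * P.p (n + 2) * P.q (n + 1)
        - P.s (n + 2) * P.q (n + 1) * P.p (n + 2) * P.q (n + 2) * P.s (n + 1)
            * P.L (n + 1) * P.q (n + 1) * P.s (n + 2)
    (-(P.L (n + 2) * P.q (n + 2)) - P.q (n + 2) * P.L (n + 2)
        + P.q (n + 2) * P.L (n + 2) * P.p (n + 2) * P.q (n + 2)
        + P.s (n + 2) * Lhp * P.s (n + 2) + snew,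
      snew)

/-- The half-integer Jucys–Murphy element `L_{i+1/2}` of the partition algebra. -/
def Lh (P : PartitionAlgebra k A) (i : ℕ) : A := (P.LSh i).1

/-- The element `σ_{i+1/2}` of the partition algebra. -/
def sigH (P : PartitionAlgebra k A) (i : ℕ) : A := (P.LSh i).2

end PartitionAlgebra

namespace PartitionAlgebra

variable {k : ℕ} {A : Type*} [Ring A] [Algebra (Polynomial ℤ) A] (P : PartitionAlgebra k A)

lemma sig_two : P.sig 2 = P.s 1 := by
  simp [sig, LS]

lemma sig_add_three (n : ℕ) :
    P.sig (n + 3) =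
      P.s (n + 1) * P.s (n + 2) * P.sig (n + 2) * P.s (n + 2) * P.s (n + 1)
        + P.s (n + 2) * P.q (n + 1) * P.L (n + 1) * P.s (n + 2) * P.q (n + 1) * P.s (n + 2)
        + P.q (n + 1) * P.L (n + 1) * P.s (n + 2) * P.q (n + 1)
        - P.s (n + 2) * P.q (n + 1) * P.L (n + 1) * P.s (n + 1) * P.q (n + 2) * P.p (n + 2)
            * P.q (n + 1)
        - P.q (n + 1) * P.p (n + 2) * P.q (n + 2) * P.s (n + 1) * P.L (n + 1) * P.q (n + 1)
            * P.s (n + 2) := by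
  rw [sig, LS]
  simp [sig, L]

lemma L_add_two (n : ℕ) :
    P.L (n + 2) =
      -(P.s (n + 1) * P.L (n + 1) * P.q (n + 1)) - P.q (n + 1) * P.L (n + 1) * P.s (n + 1)
        + P.q (n + 1) * P.L (n + 1) * P.p (n + 2) * P.q (n + 1)
        + P.s (n + 1) * P.L (n + 1) * P.s (n + 1) + P.sig (n + 2) := by
  simp only [L, sig, LS]

/-- Anything commuting with the generators of `A_n` commutes with `L_n` and `σ_n`. -/
lemma commute_L_sig {x : A} (n : ℕ) (hp : ∀ m, 1 ≤ m → m ≤ n → Commute x (P.p m))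
    (hq : ∀ m, 1 ≤ m → m < n → Commute x (P.q m))
    (hs : ∀ m, 1 ≤ m → m < n → Commute x (P.s m)) :
    Commute x (P.L n) ∧ Commute x (P.sig n) := by
  induction n using Nat.strong_induction_on with
  | _ n ih =>
    match n with
    | 0 => simp [L, sig, LS]
    | 1 => simpa [L, sig, LS] using hp 1 le_rfl le_rfl
    | n + 2 =>
      have ih' : ∀ m < n + 2, Commute x (P.L m) ∧ Commute x (P.sig m) := fun m hm =>
        ih m hm (fun i h1 h2 => hp i h1 (by omega)) (fun i h1 h2 => hq i h1 (by omega))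
          (fun i h1 h2 => hs i h1 (by omega))
      have hσ : Commute x (P.sig (n + 2)) := by
        obtain _ | n := n
        · rw [zero_add, sig_two]
          exact hs 1 le_rfl (by omega)
        · rw [sig_add_three]
          have hs₁ := hs (n + 1) (by omega) (by omega)
          have hs₂ := hs (n + 2) (by omega) (by omega)
          have hq₁ := hq (n + 1) (by omega) (by omega)
          have hq₂ := hq (n + 2) (by omega) (by omega)
          have hp₂ := hp (n + 2) (by omega) (by omega)
          have hL := (ih' (n + 1) (by omega)).1
          have hσ := (ih' (n + 2) (by omega)).2
          repeat' first
            | assumption | apply Commute.sub_right | apply Commute.add_right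
            | apply Commute.mul_right
      refine ⟨?_, hσ⟩
      rw [L_add_two]
      have hs₁ := hs (n + 1) (by omega) (by omega)
      have hq₁ := hq (n + 1) (by omega) (by omega)
      have hp₂ := hp (n + 2) (by omega) (by omega)
      have hL := (ih' (n + 1) (by omega)).1
      repeat' first
        | assumption | apply Commute.sub_right | apply Commute.add_right
        | apply Commute.neg_right | apply Commute.mul_right

variable {P}

lemma commute_q_L_sig {n j : ℕ} (hn : n < j) (hj : j ≤ k - 1) :
    Commute (P.q j) (P.L n) ∧ Commute (P.q j) (P.sig n) :=
  P.commute_L_sig n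
    (fun m h1 h2 => P.q_p j m (by omega) hj h1 (by omega) (by omega) (by omega))
    (fun m h1 h2 => P.q_comm j m (by omega) hj h1 (by omega))
    (fun m h1 h2 => (P.s_q' m j h1 (by omega) (by omega) hj (by omega) (by omega)).symm)

lemma commute_s_L_sig {n j : ℕ} (hn : n < j) (hj : j ≤ k - 1) :
    Commute (P.s j) (P.L n) ∧ Commute (P.s j) (P.sig n) :=
  P.commute_L_sig n
    (fun m h1 h2 => P.s_p j m (by omega) hj h1 (by omega) (by omega) (by omega))
    (fun m h1 h2 => P.s_q' j m (by omega) hj h1 (by omega) (by omega) (by omega))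
    (fun m h1 h2 => P.s_comm j m (by omega) hj h1 (by omega) (by omega) (by omega))

/-- `p_{i+3/2} s_i = s_i s_{i+1} p_{i+1/2} s_{i+1}`. -/
lemma q_succ_mul_s {i : ℕ} (hi : 1 ≤ i) (hik : i + 1 ≤ k - 1) :
    P.q (i + 1) * P.s i = P.s i * P.s (i + 1) * P.q i * P.s (i + 1) := by
  have h := P.sqs (i + 1) (by omega) hik
  have hs := P.s_sq i hi (by omega)
  rw [Nat.add_sub_cancel] at h
  rw [mul_assoc (P.s i), mul_assoc (P.s i), h, ← mul_assoc, ← mul_assoc, hs, one_mul]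

/-- `s_i p_{i+3/2} = s_{i+1} p_{i+1/2} s_{i+1} s_i`. -/
lemma s_mul_q_succ {i : ℕ} (hi : 1 ≤ i) (hik : i + 1 ≤ k - 1) :
    P.s i * P.q (i + 1) = P.s (i + 1) * P.q i * P.s (i + 1) * P.s i := by
  have h := P.sqs (i + 1) (by omega) hik
  have hs := P.s_sq i hi (by omega)
  rw [Nat.add_sub_cancel] at h
  rw [h, mul_assoc, hs, mul_one]

lemma q_succ_mul_s_mul_q_succ {i : ℕ} (hi : 1 ≤ i) (hik : i + 1 ≤ k - 1) :
    P.q (i + 1) * P.s i * P.q (i + 1) = P.q i * P.q (i + 1) := by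
  have hc := P.q_comm i (i + 1) hi (by omega) (by omega) hik
  rw [mul_assoc, s_mul_q_succ hi hik, ← mul_assoc, ← mul_assoc, ← mul_assoc,
    P.q_s (i + 1) (by omega) hik, ← hc, mul_assoc (P.q i), P.q_s (i + 1) (by omega) hik, hc,
    mul_assoc, P.q_s i hi (by omega)]

lemma q_mul_s_succ_mul_q {i : ℕ} (hi : 1 ≤ i) (hik : i + 1 ≤ k - 1) :
    P.q i * P.s (i + 1) * P.q i = P.q i * P.q (i + 1) := by
  have hc := P.q_comm i (i + 1) hi (by omega) (by omega) hik
  have h := P.sqs (i + 1) (by omega) hik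
  rw [Nat.add_sub_cancel] at h
  have hs := P.s_sq (i + 1) (by omega) hik
  have hl : P.s (i + 1) * P.q i = P.s i * P.q (i + 1) * P.s i * P.s (i + 1) := by
    rw [← h, mul_assoc _ (P.s (i + 1)), hs, mul_one]
  rw [mul_assoc, hl, ← mul_assoc, ← mul_assoc, ← mul_assoc, P.q_s i hi (by omega), hc,
    mul_assoc (P.q (i + 1)), P.q_s i hi (by omega), ← hc, mul_assoc,
    P.q_s (i + 1) (by omega) hik]

/-- Conjugation by `s_i s_{i+1}` carries `p_{i+1/2}` to `p_{i+3/2}`. -/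
lemma conj_q {i : ℕ} (hi : 1 ≤ i) (hik : i + 1 ≤ k - 1) :
    P.s i * P.s (i + 1) * P.q i * P.s (i + 1) * P.s i = P.q (i + 1) := by
  rw [← q_succ_mul_s hi hik, mul_assoc, P.s_sq i hi (by omega), mul_one]

/-- If `y` commutes with `s_{i+1}`, then sandwiching `s_i y s_i` between copies of `p_{i+3/2}`
amounts to conjugating `p_{i+1/2} y p_{i+1/2}` by `s_i s_{i+1}`. -/
lemma q_succ_mul_conj_mul_q_succ {i : ℕ} (hi : 1 ≤ i) (hik : i + 1 ≤ k - 1) {y : A}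
    (hy : Commute (P.s (i + 1)) y) :
    P.q (i + 1) * (P.s i * y * P.s i) * P.q (i + 1)
      = P.s i * P.s (i + 1) * (P.q i * y * P.q i) * P.s (i + 1) * P.s i := by
  have hs := P.s_sq (i + 1) (by omega) hik
  calc P.q (i + 1) * (P.s i * y * P.s i) * P.q (i + 1)
      = (P.q (i + 1) * P.s i) * y * (P.s i * P.q (i + 1)) := by simp only [mul_assoc]
    _ = P.s i * P.s (i + 1) * P.q i * ((P.s (i + 1) * y) * P.s (i + 1)) * P.q i
          * P.s (i + 1) * P.s i := by
        rw [q_succ_mul_s hi hik, s_mul_q_succ hi hik]; simp only [mul_assoc]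
    _ = _ := by
        rw [hy.eq, mul_assoc y, hs, mul_one]; simp only [mul_assoc]

/-- Conjugating by `s_i s_{i+1} s_{i+2}` shifts `p_{i+1/2} p_{i+3/2}` up by one. -/
lemma conj_q_mul_q_succ {i : ℕ} (hi : 1 ≤ i) (hik : i + 2 ≤ k - 1) :
    P.s i * (P.s (i + 1) * P.s (i + 2) * (P.q i * P.q (i + 1)) * P.s (i + 2) * P.s (i + 1))
        * P.s i = P.q (i + 1) * P.q (i + 2) := by
  have hc : P.s (i + 2) * P.q i = P.q i * P.s (i + 2) :=
    P.s_q' (i + 2) i (by omega) hik hi (by omega) (by omega) (by omega)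
  have hc' : P.s i * P.q (i + 2) = P.q (i + 2) * P.s i :=
    P.s_q' i (i + 2) hi (by omega) (by omega) hik (by omega) (by omega)
  have hs := P.s_sq (i + 1) (by omega) (by omega)
  have h₁ := conj_q (P := P) hi (by omega)
  have h₂ := conj_q (P := P) (i := i + 1) (by omega) hik
  calc _ = P.s i * P.s (i + 1) * (P.s (i + 2) * P.q i) * P.q (i + 1) * P.s (i + 2)
          * P.s (i + 1) * P.s i := by simp only [mul_assoc]
    _ = P.s i * P.s (i + 1) * P.q i * (P.s (i + 1) * P.s (i + 1)) * P.s (i + 2) * P.q (i + 1)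
          * P.s (i + 2) * P.s (i + 1) * P.s i := by
        rw [hc, hs]; simp only [mul_assoc, one_mul]
    _ = P.s i * P.s (i + 1) * P.q i * P.s (i + 1) * (P.s (i + 1) * P.s (i + 2) * P.q (i + 1)
          * P.s (i + 2) * P.s (i + 1)) * P.s i := by simp only [mul_assoc]
    _ = (P.s i * P.s (i + 1) * P.q i * P.s (i + 1) * P.s i) * P.q (i + 2) := by
        rw [h₂, mul_assoc _ (P.q (i + 2)), ← hc', ← mul_assoc]
    _ = _ := by rw [h₁]

/-- The images in `p_{i+5/2} σ_{i+2} p_{i+5/2}` of the four correction terms of `σ_{i+2}`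
all coincide. -/
lemma sandwich_corrections {i : ℕ} (hi : 1 ≤ i) (hik : i + 2 ≤ k - 1)
    (hL : P.q i * P.L i * P.q i = P.q i) :
    P.q (i + 2) * (P.s (i + 1) * P.q i * P.L i * P.s (i + 1) * P.q i * P.s (i + 1))
        * P.q (i + 2) = P.q i * P.q (i + 1) * P.q (i + 2) ∧
    P.q (i + 2) * (P.q i * P.L i * P.s (i + 1) * P.q i) * P.q (i + 2)
      = P.q i * P.q (i + 1) * P.q (i + 2) ∧
    P.q (i + 2) * (P.s (i + 1) * P.q i * P.L i * P.s i * P.q (i + 1) * P.p (i + 1) * P.q i)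
        * P.q (i + 2) = P.q i * P.q (i + 1) * P.q (i + 2) ∧
    P.q (i + 2) * (P.q i * P.p (i + 1) * P.q (i + 1) * P.s i * P.L i * P.q i * P.s (i + 1))
        * P.q (i + 2) = P.q i * P.q (i + 1) * P.q (i + 2) := by
  have cqq₁ : Commute (P.q i) (P.q (i + 1)) :=
    P.q_comm i (i + 1) hi (by omega) (by omega) (by omega)
  have cqq₂ : Commute (P.q i) (P.q (i + 2)) :=
    P.q_comm i (i + 2) hi (by omega) (by omega) hik
  have cq₁q₂ : Commute (P.q (i + 1)) (P.q (i + 2)) :=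
    P.q_comm (i + 1) (i + 2) (by omega) (by omega) (by omega) hik
  have cs₂q : Commute (P.s (i + 2)) (P.q i) :=
    P.s_q' (i + 2) i (by omega) hik hi (by omega) (by omega) (by omega)
  have csq₂ : Commute (P.s i) (P.q (i + 2)) :=
    P.s_q' i (i + 2) hi (by omega) (by omega) hik (by omega) (by omega)
  have cq₂p₁ : Commute (P.q (i + 2)) (P.p (i + 1)) :=
    P.q_p (i + 2) (i + 1) (by omega) hik (by omega) (by omega) (by omega) (by omega)
  have cq₁L : Commute (P.q (i + 1)) (P.L i) := (commute_q_L_sig (by omega) (by omega)).1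
  have cq₂L : Commute (P.q (i + 2)) (P.L i) := (commute_q_L_sig (by omega) hik).1
  have cs₁L : Commute (P.s (i + 1)) (P.L i) := (commute_s_L_sig (by omega) (by omega)).1
  have cs₂L : Commute (P.s (i + 2)) (P.L i) := (commute_s_L_sig (by omega) hik).1
  have hq₁s₁ := P.q_s (i + 1) (by omega) (by omega)
  have hs₁q₁ := P.s_q (i + 1) (by omega) (by omega)
  have hq₂s₂ := P.q_s (i + 2) (by omega) hik
  have hs₂q₂ := P.s_q (i + 2) (by omega) hik
  have hqpq := P.qpq₂ i hi (by omega)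
  have hq₁sq₁ := q_succ_mul_s_mul_q_succ (P := P) hi (by omega)
  have hq₂s₁q₂ := q_succ_mul_s_mul_q_succ (P := P) (i := i + 1) (by omega) hik
  have hq₁s₂q₁ := q_mul_s_succ_mul_q (P := P) (i := i + 1) (by omega) hik
  have hbraid := P.braid (i + 1) (by omega) hik
  have hl := q_succ_mul_s (P := P) (i := i + 1) (by omega) hik
  have hr := s_mul_q_succ (P := P) (i := i + 1) (by omega) hik
  simp only [add_assoc, Nat.reduceAdd] at hq₂s₁q₂ hq₁s₂q₁ hbraid hl hr
  generalize P.q (i + 1) = q₁ at *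
  generalize P.q (i + 2) = q₂ at *
  generalize P.s (i + 1) = s₁ at *
  generalize P.s (i + 2) = s₂ at *
  generalize P.p (i + 1) = p₁ at *
  generalize P.q i = q at *
  generalize P.s i = s at *
  generalize P.L i = l at *
  refine ⟨?_, ?_, ?_, ?_⟩
  · calc q₂ * (s₁ * q * l * s₁ * q * s₁) * q₂
        = (q₂ * s₁) * q * (l * s₁) * q * (s₁ * q₂) := by simp only [mul_assoc]
      _ = s₁ * s₂ * q₁ * (s₂ * q) * (s₁ * l) * (q * s₂) * q₁ * s₂ * s₁ := by
          rw [hl, hr, cs₁L.eq]; simp only [mul_assoc]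
      _ = s₁ * s₂ * q₁ * (s₂ * q) * s₁ * l * s₂ * q * q₁ * s₂ * s₁ := by
          rw [← cs₂q.eq]; simp only [mul_assoc]
      _ = s₁ * s₂ * (q₁ * q) * s₂ * s₁ * (l * s₂) * (q * q₁) * s₂ * s₁ := by
          rw [cs₂q.eq]; simp only [mul_assoc]
      _ = s₁ * s₂ * (q * q₁) * (s₂ * s₁ * s₂) * l * (q₁ * q) * s₂ * s₁ := by
          rw [cqq₁.eq, ← cs₂L.eq]; simp only [mul_assoc]
      _ = s₁ * s₂ * q * (q₁ * s₁) * s₂ * (s₁ * l) * (q₁ * q) * s₂ * s₁ := by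
          rw [← hbraid]; simp only [mul_assoc]
      _ = s₁ * s₂ * q * q₁ * s₂ * l * (s₁ * q₁) * q * s₂ * s₁ := by
          rw [hq₁s₁, cs₁L.eq]; simp only [mul_assoc]
      _ = s₁ * s₂ * (q * q₁) * (s₂ * l) * (q₁ * q) * s₂ * s₁ := by
          rw [hs₁q₁]; simp only [mul_assoc]
      _ = s₁ * s₂ * (q * q₁) * l * s₂ * q * q₁ * s₂ * s₁ := by
          rw [cs₂L.eq, ← cqq₁.eq]; simp only [mul_assoc]
      _ = s₁ * s₂ * q₁ * q * l * (s₂ * q) * q₁ * s₂ * s₁ := by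
          rw [cqq₁.eq]; simp only [mul_assoc]
      _ = s₁ * s₂ * q₁ * (q * l * q) * s₂ * q₁ * s₂ * s₁ := by
          rw [cs₂q.eq]; simp only [mul_assoc]
      _ = s₁ * s₂ * (q₁ * q) * s₂ * q₁ * s₂ * s₁ := by
          rw [hL]; simp only [mul_assoc]
      _ = s₁ * s₂ * q * (q₁ * s₂ * q₁) * s₂ * s₁ := by
          rw [← cqq₁.eq]; simp only [mul_assoc]
      _ = s₁ * (s₂ * q) * q₁ * (q₂ * s₂) * s₁ := by
          rw [hq₁s₂q₁]; simp only [mul_assoc]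
      _ = s₁ * q * s₂ * (q₁ * q₂) * s₁ := by
          rw [cs₂q.eq, hq₂s₂]; simp only [mul_assoc]
      _ = s₁ * q * (s₂ * q₂) * q₁ * s₁ := by
          rw [cq₁q₂.eq]; simp only [mul_assoc]
      _ = s₁ * q * q₂ * (q₁ * s₁) := by
          rw [hs₂q₂]; simp only [mul_assoc]
      _ = s₁ * q * (q₂ * q₁) := by
          rw [hq₁s₁]; simp only [mul_assoc]
      _ = s₁ * (q * q₁) * q₂ := by
          rw [← cq₁q₂.eq]; simp only [mul_assoc]
      _ = (s₁ * q₁) * q * q₂ := by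
          rw [cqq₁.eq]; simp only [mul_assoc]
      _ = q * q₁ * q₂ := by rw [hs₁q₁, cqq₁.eq]
  · calc q₂ * (q * l * s₁ * q) * q₂
        = (q₂ * (q * l)) * s₁ * (q * q₂) := by simp only [mul_assoc]
      _ = q * l * (q₂ * s₁ * q₂) * q := by
          rw [(cqq₂.symm.mul_right cq₂L).eq, cqq₂.eq]; simp only [mul_assoc]
      _ = q * l * (q₁ * q₂ * q) := by rw [hq₂s₁q₂]; simp only [mul_assoc]
      _ = (q * l * q) * q₁ * q₂ := by
          rw [← (cqq₁.mul_right cqq₂).eq]; simp only [mul_assoc]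
      _ = _ := by rw [hL]
  · have c : Commute (q * l * s * q₁ * p₁ * q) q₂ :=
      ((((cqq₂.mul_left cq₂L.symm).mul_left csq₂).mul_left cq₁q₂).mul_left
        cq₂p₁.symm).mul_left cqq₂
    calc q₂ * (s₁ * q * l * s * q₁ * p₁ * q) * q₂
        = q₂ * s₁ * ((q * l * s * q₁ * p₁ * q) * q₂) := by simp only [mul_assoc]
      _ = (q₂ * s₁ * q₂) * (q * l * s * q₁ * p₁ * q) := by
          rw [c.eq]; simp only [mul_assoc]
      _ = (q₁ * q₂) * (q * l * s * q₁ * p₁ * q) := by rw [hq₂s₁q₂]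
      _ = q₂ * (q₁ * (q * l)) * s * q₁ * p₁ * q := by
          rw [cq₁q₂.eq]; simp only [mul_assoc]
      _ = q₂ * q * l * (q₁ * s * q₁) * p₁ * q := by
          rw [(cqq₁.symm.mul_right cq₁L).eq]; simp only [mul_assoc]
      _ = q₂ * (q * l * q) * q₁ * p₁ * q := by rw [hq₁sq₁]; simp only [mul_assoc]
      _ = q₂ * (q * q₁) * p₁ * q := by rw [hL]; simp only [mul_assoc]
      _ = q₂ * q₁ * (q * p₁ * q) := by rw [cqq₁.eq]; simp only [mul_assoc]
      _ = q * q₁ * q₂ := by rw [hqpq, ← cq₁q₂.eq, ← (cqq₁.mul_right cqq₂).eq, mul_assoc]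
  · have c : Commute q₂ (q * p₁ * q₁ * s * l * q) :=
      ((((cqq₂.symm.mul_right cq₂p₁).mul_right cq₁q₂.symm).mul_right
        csq₂.symm).mul_right cq₂L).mul_right cqq₂.symm
    calc q₂ * (q * p₁ * q₁ * s * l * q * s₁) * q₂
        = (q₂ * (q * p₁ * q₁ * s * l * q)) * s₁ * q₂ := by simp only [mul_assoc]
      _ = (q * p₁ * q₁ * s * l * q) * (q₂ * s₁ * q₂) := by
          rw [c.eq]; simp only [mul_assoc]
      _ = q * p₁ * q₁ * s * (l * q * q₁) * q₂ := by rw [hq₂s₁q₂]; simp only [mul_assoc]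
      _ = q * p₁ * (q₁ * s * q₁) * l * q * q₂ := by
          rw [← (cq₁L.mul_right cqq₁.symm).eq]; simp only [mul_assoc]
      _ = (q * p₁ * q) * q₁ * l * q * q₂ := by rw [hq₁sq₁]; simp only [mul_assoc]
      _ = (q * q₁) * l * q * q₂ := by rw [hqpq]
      _ = q₁ * (q * l * q) * q₂ := by rw [cqq₁.eq]; simp only [mul_assoc]
      _ = q * q₁ * q₂ := by rw [hL, cqq₁.eq]

lemma q_sig_q_succ {i : ℕ} (hi : 1 ≤ i) (hik : i + 2 ≤ k - 1)
    (hL : P.q i * P.L i * P.q i = P.q i)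
    (hσ : P.q (i + 1) * P.sig (i + 1) * P.q (i + 1) = P.q i * P.q (i + 1)) :
    P.q (i + 2) * P.sig (i + 2) * P.q (i + 2) = P.q (i + 1) * P.q (i + 2) := by
  obtain ⟨h₁, h₂, h₃, h₄⟩ := sandwich_corrections hi hik hL
  have csq₂ : Commute (P.s i) (P.q (i + 2)) :=
    P.s_q' i (i + 2) hi (by omega) (by omega) hik (by omega) (by omega)
  have h₀ : P.q (i + 2) * (P.s i * P.s (i + 1) * P.sig (i + 1) * P.s (i + 1) * P.s i)
      * P.q (i + 2) = P.q (i + 1) * P.q (i + 2) := by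
    have h := q_succ_mul_conj_mul_q_succ (P := P) (i := i + 1) (by omega) hik
      (commute_s_L_sig (n := i + 1) (by omega) hik).2
    simp only [add_assoc, Nat.reduceAdd] at h
    calc _ = (P.q (i + 2) * P.s i) * (P.s (i + 1) * P.sig (i + 1) * P.s (i + 1))
            * (P.s i * P.q (i + 2)) := by simp only [mul_assoc]
      _ = (P.q (i + 2) * P.s i) * (P.s (i + 1) * P.sig (i + 1) * P.s (i + 1)) * P.q (i + 2)
            * P.s i := by rw [csq₂.eq]; simp only [mul_assoc]
      _ = P.s i * (P.q (i + 2) * (P.s (i + 1) * P.sig (i + 1) * P.s (i + 1)) * P.q (i + 2))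
            * P.s i := by rw [← csq₂.eq]; simp only [mul_assoc]
      _ = _ := by rw [h, hσ, conj_q_mul_q_succ hi hik]
  obtain ⟨n, rfl⟩ := Nat.exists_eq_add_of_le' hi
  rw [show n + 1 + 2 = n + 3 from rfl, sig_add_three]
  simp only [add_assoc, Nat.reduceAdd] at h₀ h₁ h₂ h₃ h₄
  simp only [mul_add, mul_sub, add_mul, sub_mul, h₀, h₁, h₂, h₃, h₄]
  abel

lemma q_L_q_succ {i : ℕ} (hi : 1 ≤ i) (hik : i + 1 ≤ k - 1)
    (hL : P.q i * P.L i * P.q i = P.q i)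
    (hσ : P.q (i + 1) * P.sig (i + 1) * P.q (i + 1) = P.q i * P.q (i + 1)) :
    P.q (i + 1) * P.L (i + 1) * P.q (i + 1) = P.q (i + 1) := by
  have cqq₁ : Commute (P.q i) (P.q (i + 1)) :=
    P.q_comm i (i + 1) hi (by omega) (by omega) (by omega)
  have cq₁L : Commute (P.q (i + 1)) (P.L i) := (commute_q_L_sig (by omega) (by omega)).1
  have cs₁L : Commute (P.s (i + 1)) (P.L i) := (commute_s_L_sig (by omega) (by omega)).1
  have hq₁sq₁ := q_succ_mul_s_mul_q_succ (P := P) hi hik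
  have hqpq := P.qpq₁ (i + 1) (by omega) hik
  have h₄ : P.q (i + 1) * (P.s i * P.L i * P.s i) * P.q (i + 1) = P.q (i + 1) := by
    rw [q_succ_mul_conj_mul_q_succ hi hik cs₁L, hL, conj_q hi hik]
  have h₁ : P.q (i + 1) * (P.s i * P.L i * P.q i) * P.q (i + 1) = P.q i * P.q (i + 1) := by
    calc _ = P.q (i + 1) * P.s i * (P.L i * P.q i * P.q (i + 1)) := by simp only [mul_assoc]
      _ = (P.q (i + 1) * P.s i * P.q (i + 1)) * P.L i * P.q i := by
          rw [← (cq₁L.mul_right cqq₁.symm).eq]; simp only [mul_assoc]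
      _ = P.q (i + 1) * (P.q i * P.L i * P.q i) := by
          rw [hq₁sq₁, cqq₁.eq]; simp only [mul_assoc]
      _ = _ := by rw [hL, cqq₁.eq]
  have h₂ : P.q (i + 1) * (P.q i * P.L i * P.s i) * P.q (i + 1) = P.q i * P.q (i + 1) := by
    calc _ = (P.q (i + 1) * (P.q i * P.L i)) * P.s i * P.q (i + 1) := by simp only [mul_assoc]
      _ = P.q i * P.L i * (P.q (i + 1) * P.s i * P.q (i + 1)) := by
          rw [(cqq₁.symm.mul_right cq₁L).eq]; simp only [mul_assoc]
      _ = (P.q i * P.L i * P.q i) * P.q (i + 1) := by rw [hq₁sq₁]; simp only [mul_assoc]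
      _ = _ := by rw [hL]
  have h₃ : P.q (i + 1) * (P.q i * P.L i * P.p (i + 1) * P.q i) * P.q (i + 1)
      = P.q i * P.q (i + 1) := by
    calc _ = (P.q (i + 1) * (P.q i * P.L i)) * P.p (i + 1) * (P.q i * P.q (i + 1)) := by
          simp only [mul_assoc]
      _ = P.q i * P.L i * (P.q (i + 1) * P.p (i + 1) * P.q (i + 1)) * P.q i := by
          rw [(cqq₁.symm.mul_right cq₁L).eq, cqq₁.eq]; simp only [mul_assoc]
      _ = (P.q i * P.L i * P.q i) * P.q (i + 1) := by
          rw [hqpq, mul_assoc _ (P.q (i + 1)), ← cqq₁.eq]; simp only [mul_assoc]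
      _ = _ := by rw [hL]
  obtain ⟨n, rfl⟩ := Nat.exists_eq_add_of_le' hi
  rw [show n + 1 + 1 = n + 2 from rfl] at *
  rw [L_add_two]
  simp only [mul_add, mul_sub, mul_neg, neg_mul, add_mul, sub_mul, h₁, h₂, h₃, h₄, hσ]
  abel

lemma q_L_q_and_q_sig_q {i : ℕ} (hi : 1 ≤ i) (hik : i ≤ k - 1) :
    P.q i * P.L i * P.q i = P.q i ∧ (i + 1 ≤ k - 1 →
      P.q (i + 1) * P.sig (i + 1) * P.q (i + 1) = P.q i * P.q (i + 1)) := by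
  induction i, hi using Nat.le_induction with
  | base =>
    refine ⟨by simpa [L, LS] using P.qpq₁ 1 le_rfl hik, fun h => ?_⟩
    rw [sig_two]
    exact q_succ_mul_s_mul_q_succ le_rfl h
  | succ i hi ih =>
    obtain ⟨hL, hσ⟩ := ih (by omega)
    exact ⟨q_L_q_succ hi hik hL (hσ hik), fun h => q_sig_q_succ hi h hL (hσ hik)⟩

end PartitionAlgebra

/-- Proposition 3.2(5): `p_{i+1/2} L_i p_{i+1/2} = p_{i+1/2}` for `1 ≤ i ≤ k-1`. -/
theorem partitionAlgebra_q_L_q {k : ℕ} (hk : 2 ≤ k) {A : Type*} [Ring A]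
    [Algebra (Polynomial ℤ) A] (P : PartitionAlgebra k A) :
    ∀ i, 1 ≤ i → i ≤ k - 1 → P.q i * P.L i * P.q i = P.q i := by
  intro i hi hik
  exact (PartitionAlgebra.q_L_q_and_q_sig_q hi hik).1
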